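/- The norm-comparison constant C_{7,4} equals √7; that is, every nonzero 4-covector φ on ℝ⁷ satisfies |φ|* ≤ √7 · ‖φ‖*, and there exists a nonzero 4-covector φ on ℝ⁷ with |φ|* = √7 · ‖φ‖*. -/

import Mathlib

open scoped Classical

/-- A `p`-covector on `ℝⁿ`: a continuous alternating `p`-linear form on
`EuclideanSpace ℝ (Fin n)`. -/
abbrev Covector (n p : ℕ) := EuclideanSpace ℝ (Fin n) [⋀^Fin p]→L[ℝ] ℝ

/-- The comass of a real-valued function of `p` vectors in `ℝⁿ`: the supremum of
its absolute values on orthonormal families. -/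
noncomputable def comassFun {n p : ℕ}
    (F : (Fin p → EuclideanSpace ℝ (Fin n)) → ℝ) : ℝ :=
  sSup {r : ℝ | ∃ v : Fin p → EuclideanSpace ℝ (Fin n), Orthonormal ℝ v ∧ r = |F v|}

/-- The comass norm `‖φ‖*` of a `p`-covector. -/
noncomputable def comass {n p : ℕ} (φ : Covector n p) : ℝ :=
  comassFun (fun v => φ v)

/-- The Euclidean norm `|φ|*` of a `p`-covector, computed from its coefficients
on the standard orthonormal basis, indexed by strictly increasing multi-indices. -/
noncomputable def euclNorm {n p : ℕ} (φ : Covector n p) : ℝ :=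
  Real.sqrt (∑ f : {f : Fin p → Fin n // StrictMono f},
    (φ (fun i => EuclideanSpace.single (f.1 i) 1)) ^ 2)

/-- The norm-comparison constant `C_{n,p}`: the supremum of `|φ|*/‖φ‖*` over all
nonzero `p`-covectors on `ℝⁿ`. -/
noncomputable def normComparisonConst (n p : ℕ) : ℝ :=
  sSup {r : ℝ | ∃ φ : Covector n p, φ ≠ 0 ∧ r = euclNorm φ / comass φ}

open scoped RealInnerProductSpace

/-! ### Upper bound -/

section Skew

variable {E : Type*} [NormedAddCommGroup E] [InnerProductSpace ℝ E] [FiniteDimensional ℝ E]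

/-- A skew operator in odd dimension has a unit vector in its kernel. -/
theorem skew_kernel (T : E →ₗ[ℝ] E) (hT : ∀ x y, ⟪T x, y⟫ = -⟪x, T y⟫)
    (hd : Odd (Module.finrank ℝ E)) : ∃ u : E, ‖u‖ = 1 ∧ T u = 0 := by
  have hadj : LinearMap.adjoint T = -T := by
    symm
    rw [LinearMap.eq_adjoint_iff]
    intro x y
    simp [hT]
  have hdet : LinearMap.det T = 0 := by
    have h1 : LinearMap.det (LinearMap.adjoint T) = LinearMap.det T := by
      let b := stdOrthonormalBasis ℝ E
      rw [← LinearMap.det_toMatrix b.toBasis, ← LinearMap.det_toMatrix b.toBasis,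
        LinearMap.toMatrix_adjoint]
      rw [Matrix.det_conjTranspose]
      simp
    rw [hadj, show -T = (-1 : ℝ) • T by simp, LinearMap.det_smul, hd.neg_one_pow] at h1
    linarith
  have hker : LinearMap.ker T ≠ ⊥ := by
    have := LinearMap.bot_lt_ker_of_det_eq_zero hdet
    exact this.ne'
  obtain ⟨w, hw, hw0⟩ := Submodule.exists_mem_ne_zero_of_ne_bot hker
  refine ⟨(‖w‖⁻¹ : ℝ) • w, ?_, ?_⟩
  · rw [norm_smul, norm_inv, norm_norm, inv_mul_cancel₀ (norm_ne_zero_iff.2 hw0)]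
  · rw [map_smul, LinearMap.mem_ker.1 hw, smul_zero]

theorem skew_sum_basis {ι κ : Type*} [Fintype ι] [Fintype κ]
    (T : E →ₗ[ℝ] E) (hT : ∀ x y, ⟪T x, y⟫ = -⟪x, T y⟫)
    (b : OrthonormalBasis ι ℝ E) (b' : OrthonormalBasis κ ℝ E) :
    ∑ i, ‖T (b i)‖ ^ 2 = ∑ j, ‖T (b' j)‖ ^ 2 := by
  have h1 : ∀ i, ‖T (b i)‖ ^ 2 = ∑ j, ⟪b' j, T (b i)⟫ ^ 2 := by
    intro i
    rw [← b'.sum_sq_norm_inner_right]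
    simp
  have h2 : ∀ j, ‖T (b' j)‖ ^ 2 = ∑ i, ⟪b i, T (b' j)⟫ ^ 2 := by
    intro i
    rw [← b.sum_sq_norm_inner_right]
    simp
  simp_rw [h1, h2]
  rw [Finset.sum_comm]
  refine Finset.sum_congr rfl fun j _ => Finset.sum_congr rfl fun i _ => ?_
  rw [real_inner_comm, hT]
  ring

theorem skew_bound {ι : Type*} [Fintype ι]
    (T : E →ₗ[ℝ] E) (hT : ∀ x y, ⟪T x, y⟫ = -⟪x, T y⟫)
    (hd : Module.finrank ℝ E = 5) (b : OrthonormalBasis ι ℝ E) (c : ℝ) (hc : 0 ≤ c)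
    (h : ∀ x y : E, ‖x‖ = 1 → ‖y‖ = 1 → ⟪x, y⟫ = 0 → |⟪x, T y⟫| ≤ c) :
    ∑ i, ‖T (b i)‖ ^ 2 ≤ 4 * c ^ 2 := by
  have hn : ∀ y : E, ‖y‖ = 1 → ‖T y‖ ≤ c := by
    intro y hy
    by_cases h0 : T y = 0
    · simpa [h0] using hc
    have hne : ‖T y‖ ≠ 0 := norm_ne_zero_iff.2 h0
    have hyy : ⟪T y, y⟫ = 0 := by
      have := hT y y
      rw [real_inner_comm] at this
      rw [real_inner_comm]
      linarith
    have := h ((‖T y‖⁻¹ : ℝ) • T y) y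
      (by rw [norm_smul, norm_inv, norm_norm, inv_mul_cancel₀ hne]) hy
      (by rw [real_inner_smul_left, hyy, mul_zero])
    rw [real_inner_smul_left, real_inner_self_eq_norm_sq] at this
    have h3 : ‖T y‖⁻¹ * ‖T y‖ ^ 2 = ‖T y‖ := by field_simp
    rw [h3] at this
    exact (le_abs_self _).trans this
  obtain ⟨u, hu, hTu⟩ := skew_kernel T hT (by rw [hd]; decide)
  have hons : Orthonormal ℝ ((↑) : ({u} : Set E) → E) := by
    rw [orthonormal_subtype_iff_ite]
    rintro v rfl w rfl
    simp [hu]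
  obtain ⟨s, b', hs, hb'⟩ := hons.exists_orthonormalBasis_extension
  rw [skew_sum_basis T hT b b', hb']
  have hus : u ∈ s := by exact_mod_cast hs rfl
  have hcard : s.card = 5 := by
    rw [← hd, Module.finrank_eq_card_basis b'.toBasis]
    simp
  have hnorm : ∀ v : s, ‖(v : E)‖ = 1 := by
    intro v
    have := b'.orthonormal.1 v
    rwa [hb'] at this
  rw [Finset.sum_coe_sort s (fun v => ‖T v‖ ^ 2), ← Finset.add_sum_erase s _ hus, hTu]
  have : ∑ v ∈ s.erase u, ‖T v‖ ^ 2 ≤ (s.erase u).card • c ^ 2 := by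
    apply Finset.sum_le_card_nsmul
    intro v hv
    have := hn v (hnorm ⟨v, Finset.mem_of_mem_erase hv⟩)
    gcongr
  rw [Finset.card_erase_of_mem hus, hcard] at this
  simpa using this

end Skew

abbrev R7 := EuclideanSpace ℝ (Fin 7)

noncomputable abbrev ee (i : Fin 7) : R7 := EuclideanSpace.single i 1

theorem ee_orthonormal : Orthonormal ℝ ee := by
  have := (EuclideanSpace.basisFun (Fin 7) ℝ).orthonormal
  have h : ⇑(EuclideanSpace.basisFun (Fin 7) ℝ) = ee := by
    funext i
    simp
  rwa [h] at this

theorem le_comass (φ : Covector 7 4) (v : Fin 4 → R7) (hv : Orthonormal ℝ v) :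
    |φ v| ≤ comass φ := by
  apply le_csSup
  · refine ⟨‖φ‖, ?_⟩
    rintro r ⟨w, hw, rfl⟩
    have := φ.le_opNorm w
    simpa [hw.1] using this
  · exact ⟨v, hv, rfl⟩

theorem comass_nonneg' (φ : Covector 7 4) : 0 ≤ comass φ := by
  apply Real.sSup_nonneg
  rintro r ⟨w, hw, rfl⟩
  exact abs_nonneg _

theorem slot3 (φ : Covector 7 4) (a b c : R7) :
    ∃ L : R7 →ₗ[ℝ] ℝ, ∀ x, L x = φ ![a, b, c, x] := by
  refine ⟨φ.toAlternatingMap.toMultilinearMap.toLinearMap ![a, b, c, 0] 3, fun x => ?_⟩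
  simp only [MultilinearMap.toLinearMap_apply]
  change φ _ = φ _
  congr 1
  ext i
  fin_cases i <;> rfl

theorem swap23 (φ : Covector 7 4) (a b x y : R7) :
    φ ![a, b, x, y] = -φ ![a, b, y, x] := by
  have := φ.toAlternatingMap.map_swap ![a, b, y, x] (i := 2) (j := 3) (by decide)
  refine Eq.trans ?_ this
  change φ _ = φ _
  congr 1
  ext i
  fin_cases i <;> rfl

theorem pair_bound (φ : Covector 7 4) (i j : Fin 7) (hij : i ≠ j) :
    ∑ k, ∑ l, φ ![ee i, ee j, ee k, ee l] ^ 2 ≤ 4 * comass φ ^ 2 := by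
  let S := {k : Fin 7 // k ≠ i ∧ k ≠ j}
  let E := EuclideanSpace ℝ S
  let J : E →ₗ[ℝ] R7 := ∑ k : S, (LinearMap.toSpanSingleton ℝ R7 (ee k)).comp
    (EuclideanSpace.proj k : E →L[ℝ] ℝ).toLinearMap
  have hJ : ∀ x : E, J x = ∑ k : S, x k • ee k := by
    intro x
    simp [J]
    rfl
  have hJs : ∀ l : S, J (EuclideanSpace.single l 1) = ee l := by
    intro l
    rw [hJ, Finset.sum_eq_single l] <;> simp +contextual
  choose L hL using slot3 φ (ee i) (ee j)
  let T : E →ₗ[ℝ] E :=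
    (WithLp.linearEquiv 2 ℝ (S → ℝ)).symm.toLinearMap.comp
      (LinearMap.pi fun k : S => (L (ee k)).comp J)
  have hTa : ∀ y k, T y k = φ ![ee i, ee j, ee k, J y] := by
    intro y k
    rw [← hL]
    rfl
  have hTi : ∀ x y, ⟪x, T y⟫ = φ ![ee i, ee j, J x, J y] := by
    intro x y
    rw [swap23, ← hL, hJ x, map_sum, PiLp.inner_apply, ← Finset.sum_neg_distrib]
    refine Finset.sum_congr rfl fun k _ => ?_
    rw [map_smul, hL, hTa, swap23]
    simp
    ring
  have hskew : ∀ x y, ⟪T x, y⟫ = -⟪x, T y⟫ := by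
    intro x y
    rw [real_inner_comm, hTi, hTi, swap23]
  have hon : Orthonormal ℝ (fun k : S => ee k) :=
    ee_orthonormal.comp _ Subtype.val_injective
  have hJi : ∀ x y, ⟪J x, J y⟫ = ⟪x, y⟫ := by
    intro x y
    rw [hJ, hJ, hon.inner_sum, PiLp.inner_apply]
    simp [mul_comm]
  have hJn : ∀ x, ‖J x‖ = ‖x‖ := by
    intro x
    rw [← sq_eq_sq₀ (norm_nonneg _) (norm_nonneg _), ← real_inner_self_eq_norm_sq, hJi,
      real_inner_self_eq_norm_sq]
  have hperp : ∀ m, (m = i ∨ m = j) → ∀ x, ⟪ee m, J x⟫ = 0 := by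
    intro m hm x
    rw [hJ, inner_sum]
    refine Finset.sum_eq_zero fun k _ => ?_
    rw [inner_smul_right, ee_orthonormal.2, mul_zero]
    rintro rfl
    rcases hm with h | h
    · exact k.2.1 h
    · exact k.2.2 h
  have hb := skew_bound T hskew (by
      have : Fintype.card S = 5 := by
        have h2 : Fintype.card S = ((Finset.univ.erase i).erase j).card := by
          rw [Fintype.card_subtype]
          congr 1
          ext k
          simp [and_comm]
        rw [h2, Finset.card_erase_of_mem (by simp [hij.symm]), Finset.card_erase_of_mem (by simp)]
        simp
      simp [E, this]) (EuclideanSpace.basisFun S ℝ) (comass φ) (comass_nonneg' φ) (by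
      intro x y hx hy hxy
      rw [hTi]
      apply le_comass
      have hij0 := ee_orthonormal.2 hij
      have e1 := ee_orthonormal.1 i
      have e2 := ee_orthonormal.1 j
      have p1 := hperp i (Or.inl rfl)
      have p2 := hperp j (Or.inr rfl)
      constructor
      · intro m
        fin_cases m
        · exact e1
        · exact e2
        · exact (hJn x).trans hx
        · exact (hJn y).trans hy
      · have key : ∀ a b : Fin 4, a < b →
            ⟪(![ee i, ee j, J x, J y] : Fin 4 → R7) a, (![ee i, ee j, J x, J y] : Fin 4 → R7) b⟫
              = 0 := by
          intro a b hab
          fin_cases a <;> fin_cases b <;> first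
            | (exfalso; revert hab; decide)
            | exact hij0
            | exact p1 x
            | exact p1 y
            | exact p2 x
            | exact p2 y
            | exact (hJi x y).trans hxy
        intro a b hab
        rcases lt_or_gt_of_ne hab with h | h
        · exact key a b h
        · rw [real_inner_comm]
          exact key b a h)
  refine le_trans (le_of_eq ?_) hb
  have hz : ∀ k l, ¬(k ≠ i ∧ k ≠ j) → φ ![ee i, ee j, ee k, ee l] = 0 := by
    intro k l hk
    by_cases h1 : k = i
    · subst h1
      exact φ.toAlternatingMap.map_eq_zero_of_eq _ (i := 0) (j := 2) rfl (by decide)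
    · have h2 : k = j := by tauto
      subst h2
      exact φ.toAlternatingMap.map_eq_zero_of_eq _ (i := 1) (j := 2) rfl (by decide)
  have red : ∀ F : Fin 7 → ℝ, (∀ k, ¬(k ≠ i ∧ k ≠ j) → F k = 0) → ∑ k, F k = ∑ k : S, F k := by
    intro F hF
    rw [← Finset.sum_subtype (Finset.univ.filter fun k => k ≠ i ∧ k ≠ j) (by simp) F,
      Finset.sum_filter]
    refine Finset.sum_congr rfl fun k _ => ?_
    split_ifs with h
    · rfl
    · exact hF k h
  rw [Finset.sum_comm, red]
  · refine Finset.sum_congr rfl fun l _ => ?_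
    rw [red, EuclideanSpace.norm_sq_eq]
    · refine Finset.sum_congr rfl fun k _ => ?_
      rw [hTa, EuclideanSpace.basisFun_apply, hJs]
      simp
    · intro k hk
      rw [hz k _ hk]
      simp
  · intro l hl
    refine Finset.sum_eq_zero fun k _ => ?_
    rw [swap23, hz l k hl]
    simp

theorem sum_all_eq (F : (Fin 4 → Fin 7) → ℝ) (h0 : ∀ f, ¬ Function.Injective f → F f = 0)
    (hp : ∀ f (σ : Equiv.Perm (Fin 4)), F (f ∘ σ) = F f) :
    ∑ f, F f = 24 * ∑ f : {f : Fin 4 → Fin 7 // StrictMono f}, F f.1 := by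
  have h1 : ∑ f, F f = ∑ p : {f : Fin 4 → Fin 7 // StrictMono f} × Equiv.Perm (Fin 4),
      F (p.1.1 ∘ p.2) := by
    symm
    apply Finset.sum_of_injOn (fun p => p.1.1 ∘ p.2)
    · rintro ⟨⟨f, hf⟩, σ⟩ - ⟨⟨g, hg⟩, τ⟩ - h
      simp only at h
      have hr : Set.range f = Set.range g := by
        rw [← σ.surjective.range_comp f, h, τ.surjective.range_comp g]
      have hfg : f = g := (StrictMono.range_inj hf hg).1 hr
      subst hfg
      have : σ = τ := by
        ext1 a
        exact hf.injective (congrFun h a)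
      subst this
      rfl
    · simp
    · intro f _ hf
      apply h0
      intro hinj
      apply hf
      refine ⟨(⟨f ∘ Tuple.sort f, ?_⟩, (Tuple.sort f)⁻¹), by simp, ?_⟩
      · exact (Tuple.monotone_sort f).strictMono_of_injective
          (hinj.comp (Tuple.sort f).injective)
      · ext a
        simp
    · intros
      rfl
  rw [h1, Fintype.sum_prod_type, Finset.mul_sum]
  refine Finset.sum_congr rfl fun f _ => ?_
  simp_rw [hp]
  simp [Fintype.card_perm, Nat.factorial]

theorem upper_bound (φ : Covector 7 4) : euclNorm φ ≤ Real.sqrt 7 * comass φ := by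
  have hs := sum_all_eq (fun f => φ (fun i => ee (f i)) ^ 2)
    (by
      intro f hf
      simp only [Function.Injective, not_forall] at hf
      obtain ⟨a, b, hab, hne⟩ := hf
      have := φ.toAlternatingMap.map_eq_zero_of_eq (fun i => ee (f i)) (i := a) (j := b)
        (by simp only [hab]) hne
      have h' : φ (fun i => ee (f i)) = 0 := this
      simp only [h']
      norm_num)
    (by
      intro f σ
      have := φ.toAlternatingMap.map_perm (fun i => ee (f i)) σ
      have h' : φ (fun i => ee ((f ∘ σ) i)) = Equiv.Perm.sign σ • φ (fun i => ee (f i)) := this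
      simp only [h']
      rcases Int.units_eq_one_or (Equiv.Perm.sign σ) with h | h <;> simp [h])
  have ht : ∑ f : Fin 4 → Fin 7, φ (fun i => ee (f i)) ^ 2
      = ∑ i, ∑ j, ∑ k, ∑ l, φ ![ee i, ee j, ee k, ee l] ^ 2 := by
    simp only [← Fintype.sum_prod_type']
    refine Fintype.sum_equiv
      ⟨fun f => (f 0, f 1, f 2, f 3), fun p => ![p.1, p.2.1, p.2.2.1, p.2.2.2], ?_, ?_⟩ _ _ ?_
    · intro f
      ext a
      fin_cases a <;> rfl
    · intro p
      rfl
    · intro f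
      have : (fun i => ee (f i)) = ![ee (f 0), ee (f 1), ee (f 2), ee (f 3)] := by
        ext1 a
        fin_cases a <;> rfl
      rw [this]
      rfl
  have hb : ∑ i, ∑ j, ∑ k, ∑ l, φ ![ee i, ee j, ee k, ee l] ^ 2 ≤
      ∑ i : Fin 7, ∑ j : Fin 7, if i = j then 0 else 4 * comass φ ^ 2 := by
    refine Finset.sum_le_sum fun i _ => Finset.sum_le_sum fun j _ => ?_
    split_ifs with h
    · subst h
      refine le_of_eq (Finset.sum_eq_zero fun k _ => Finset.sum_eq_zero fun l _ => ?_)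
      have : φ ![ee i, ee i, ee k, ee l] = 0 :=
        φ.toAlternatingMap.map_eq_zero_of_eq _ (i := 0) (j := 1) rfl (by decide)
      rw [this]
      norm_num
    · exact pair_bound φ i j h
  have hc : ∑ i : Fin 7, ∑ j : Fin 7, (if i = j then 0 else 4 * comass φ ^ 2)
      = 168 * comass φ ^ 2 := by
    have e : ∀ (a : ℝ) (i j : Fin 7),
        (if i = j then (0 : ℝ) else a) = a - if i = j then a else 0 := by
      intro a i j
      split_ifs <;> simp
    simp only [e, Finset.sum_sub_distrib, Finset.sum_ite_eq, Finset.mem_univ, if_true,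
      Finset.sum_const, Finset.card_univ, Fintype.card_fin, nsmul_eq_mul]
    push_cast
    ring
  rw [hc, ← ht, hs] at hb
  unfold euclNorm
  apply Real.sqrt_le_iff.2
  refine ⟨mul_nonneg (Real.sqrt_nonneg _) (comass_nonneg' φ), ?_⟩
  rw [mul_pow, Real.sq_sqrt (by norm_num)]
  change ∑ f : {f : Fin 4 → Fin 7 // StrictMono f}, φ (fun i => ee (f.1 i)) ^ 2 ≤ _
  linarith

/-! ### The extremal form -/

/-- The seven-dimensional cross product. -/
noncomputable def cr (x y : R7) : R7 := WithLp.toLp 2 fun k =>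
  x (k + 1) * y (k + 3) - x (k + 3) * y (k + 1) + x (k + 2) * y (k + 6) - x (k + 6) * y (k + 2)
    + x (k + 4) * y (k + 5) - x (k + 5) * y (k + 4)

theorem cr_add_left (x x' y : R7) : cr (x + x') y = cr x y + cr x' y := by
  ext k
  simp [cr]
  ring

theorem cr_smul_left (c : ℝ) (x y : R7) : cr (c • x) y = c • cr x y := by
  ext k
  simp [cr]
  ring

theorem cr_swap (x y : R7) : cr x y = - cr y x := by
  ext k
  simp [cr]
  ring

theorem cr_self (x : R7) : cr x x = 0 := by
  ext k
  simp [cr]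
  ring

theorem cr_add_right (x y y' : R7) : cr x (y + y') = cr x y + cr x y' := by
  ext k
  simp [cr]
  ring

theorem cr_smul_right (c : ℝ) (x y : R7) : cr x (c • y) = c • cr x y := by
  ext k
  simp [cr]
  ring

theorem inner7 (x y : R7) : ⟪x, y⟫ = x 0 * y 0 + x 1 * y 1 + x 2 * y 2 + x 3 * y 3 + x 4 * y 4
    + x 5 * y 5 + x 6 * y 6 := by
  rw [PiLp.inner_apply]
  simp [Fin.sum_univ_seven]
  ring

theorem cr_inner (x y w : R7) :
    ⟪cr x y, cr y w⟫ = ⟪x, y⟫ * ⟪y, w⟫ - ⟪x, w⟫ * ⟪y, y⟫ := by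
  simp only [inner7, cr]
  simp only [Fin.isValue, Fin.reduceAdd, zero_add]
  ring

noncomputable def psi (x y z w : R7) : ℝ :=
  ⟪cr x y, cr z w⟫ - ⟪x, z⟫ * ⟪y, w⟫ + ⟪x, w⟫ * ⟪y, z⟫

theorem psi01 (x z w : R7) : psi x x z w = 0 := by
  simp [psi, cr_self]
  ring

theorem psi23 (x y z : R7) : psi x y z z = 0 := by
  simp [psi, cr_self]

theorem psi12 (x y w : R7) : psi x y y w = 0 := by
  simp only [psi, cr_inner]
  ring

theorem psi_swap01 (x y z w : R7) : psi x y z w = - psi y x z w := by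
  simp only [psi]
  rw [cr_swap x y, inner_neg_left]
  ring

theorem psi_swap23 (x y z w : R7) : psi x y z w = - psi x y w z := by
  simp only [psi]
  rw [cr_swap z w, inner_neg_right]
  ring

theorem cr_cont : Continuous fun p : R7 × R7 => cr p.1 p.2 := by
  unfold cr
  fun_prop

noncomputable def Psi : Covector 7 4 where
  toFun v := psi (v 0) (v 1) (v 2) (v 3)
  map_update_add' := by
    intro inst v i x y
    have : inst = instDecidableEqFin 4 := Subsingleton.elim _ _
    subst this
    fin_cases i <;>
    simp [psi, cr_add_left, cr_add_right, inner_add_left, inner_add_right, Function.update] <;> ring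
  map_update_smul' := by
    intro inst v i x y
    have : inst = instDecidableEqFin 4 := Subsingleton.elim _ _
    subst this
    fin_cases i <;>
    simp [psi, cr_smul_left, cr_smul_right, inner_smul_left, inner_smul_right,
      Function.update] <;> ring
  cont := by
    have h1 : Continuous fun v : Fin 4 → R7 => cr (v 0) (v 1) :=
      cr_cont.comp (f := fun v : Fin 4 → R7 => (v 0, v 1))
        ((continuous_apply 0).prodMk (continuous_apply 1))
    have h2 : Continuous fun v : Fin 4 → R7 => cr (v 2) (v 3) :=
      cr_cont.comp (f := fun v : Fin 4 → R7 => (v 2, v 3))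
        ((continuous_apply 2).prodMk (continuous_apply 3))
    unfold psi
    fun_prop
  map_eq_zero_of_eq' := by
    have key : ∀ (v : Fin 4 → R7) (a b : Fin 4), a < b → v a = v b →
        psi (v 0) (v 1) (v 2) (v 3) = 0 := by
      intro v a b hab h
      fin_cases a <;> fin_cases b <;> first
        | (exfalso; revert hab; decide)
        | skip
      · replace h : v 0 = v 1 := h
        rw [h, psi01]
      · replace h : v 0 = v 2 := h
        rw [h, psi_swap01, psi12, neg_zero]
      · replace h : v 0 = v 3 := h
        rw [h, psi_swap01, psi_swap23, psi12, neg_zero, neg_zero]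
      · replace h : v 1 = v 2 := h
        rw [h, psi12]
      · replace h : v 1 = v 3 := h
        rw [h, psi_swap23, psi12, neg_zero]
      · replace h : v 2 = v 3 := h
        rw [h, psi23]
    intro v a b h hab
    rcases lt_or_gt_of_ne hab with h' | h'
    · exact key v a b h' h
    · exact key v b a h' h.symm

theorem Psi_apply (v : Fin 4 → R7) : Psi v = psi (v 0) (v 1) (v 2) (v 3) := rfl

theorem cr_norm (x y : R7) (hx : ‖x‖ = 1) (hy : ‖y‖ = 1) (hxy : ⟪x, y⟫ = 0) : ‖cr x y‖ = 1 := by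
  have h := cr_inner x y x
  rw [cr_swap y x, inner_neg_right, real_inner_self_eq_norm_sq, real_inner_self_eq_norm_sq,
    real_inner_self_eq_norm_sq, hx, hy, hxy] at h
  have h' : ‖cr x y‖ ^ 2 = 1 := by linarith
  nlinarith [norm_nonneg (cr x y)]

theorem Psi_comass : comass Psi ≤ 1 := by
  apply Real.sSup_le _ zero_le_one
  rintro r ⟨v, hv, rfl⟩
  simp only [Psi_apply, psi]
  rw [hv.2 (show (0 : Fin 4) ≠ 2 by decide), hv.2 (show (0 : Fin 4) ≠ 3 by decide)]
  have h := abs_real_inner_le_norm (cr (v 0) (v 1)) (cr (v 2) (v 3))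
  rw [cr_norm _ _ (hv.1 0) (hv.1 1) (hv.2 (by decide)),
    cr_norm _ _ (hv.1 2) (hv.1 3) (hv.2 (by decide))] at h
  simpa using h

def quad : Fin 7 → Fin 4 → Fin 7 :=
  ![![2, 4, 5, 6], ![0, 3, 5, 6], ![0, 1, 4, 6], ![0, 1, 2, 5], ![1, 2, 3, 6], ![0, 2, 3, 4],
    ![1, 3, 4, 5]]

theorem quad_mono : ∀ i, StrictMono (quad i) := by
  intro i
  rw [Fin.strictMono_iff_lt_succ]
  revert i
  decide

theorem quad_inj : Function.Injective quad := by
  decide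

theorem Psi_quad (i : Fin 7) : Psi (fun a => ee (quad i a)) ^ 2 = 1 := by
  rw [Psi_apply]
  simp only [psi, inner7, cr]
  fin_cases i <;> simp [quad, Fin.ext_iff]

theorem Psi_norm : Real.sqrt 7 ≤ euclNorm Psi := by
  unfold euclNorm
  apply Real.sqrt_le_sqrt
  let q : Fin 7 ↪ {f : Fin 4 → Fin 7 // StrictMono f} :=
    ⟨fun i => ⟨quad i, quad_mono i⟩, fun i j h => quad_inj (congrArg Subtype.val h)⟩
  have h := Finset.sum_le_sum_of_subset_of_nonneg (Finset.subset_univ (Finset.univ.map q))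
    (f := fun f : {f : Fin 4 → Fin 7 // StrictMono f} => Psi (fun i => ee (f.1 i)) ^ 2)
    (fun _ _ _ => sq_nonneg _)
  rw [Finset.sum_map] at h
  refine le_trans (le_of_eq ?_) h
  have : ∀ i, Psi (fun a => ee ((q i).1 a)) ^ 2 = 1 := Psi_quad
  simp only [this]
  simp

/-- `C_{7,4} = √7`. -/
theorem C_seven_four_eq_sqrt_seven :
    (∀ φ : Covector 7 4, φ ≠ 0 → euclNorm φ ≤ Real.sqrt 7 * comass φ) ∧
    (∃ φ : Covector 7 4, φ ≠ 0 ∧ euclNorm φ = Real.sqrt 7 * comass φ) := by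
  refine ⟨fun φ _ => upper_bound φ, Psi, ?_, ?_⟩
  · intro h
    have := Psi_quad 0
    rw [h] at this
    simp at this
  · apply le_antisymm (upper_bound Psi)
    refine le_trans ?_ Psi_norm
    have := mul_le_mul_of_nonneg_left Psi_comass (Real.sqrt_nonneg 7)
    simpa using this
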